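/- Let V be a type, R : V → V → Prop a directed edge relation, v : V, and a c d : List V such that v ∉ a, v ∉ d, and List.Chain' R (a ++ v :: c ++ v :: d). Then the shortcutted list a ++ v :: d satisfies: (1) List.Chain' R (a ++ v :: d); (2) v occurs exactly once in a ++ v :: d; (3) it has the same head and the same last element as a ++ v :: c ++ v :: d; and (4) every consecutive pair of a ++ v :: d is a consecutive pair of a ++ v :: c ++ v :: d. -/

import Mathlib

theorem pairs_split {V : Type*} (v : V) (t : List V) (p : V × V) (a : List V) :
    p ∈ (a ++ v :: t).zip (a ++ v :: t).tail ↔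
      p ∈ (a ++ [v]).zip (a ++ [v]).tail ∨ p ∈ (v :: t).zip (v :: t).tail := by
  induction a with
  | nil => simp
  | cons x a ih =>
    cases a with
    | nil => simp
    | cons y a =>
      simp only [List.cons_append, List.tail_cons, List.zip_cons_cons, List.mem_cons] at ih ⊢
      rw [ih, or_assoc]

theorem stmt_7 {V : Type*} [DecidableEq V] (R : V → V → Prop) (v : V) (a c d : List V)
    (hva : v ∉ a) (hvd : v ∉ d)
    (h : List.Chain' R (a ++ v :: c ++ v :: d)) :
    List.Chain' R (a ++ v :: d) ∧
    (a ++ v :: d).count v = 1 ∧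
    (a ++ v :: d).head? = (a ++ v :: c ++ v :: d).head? ∧
    (a ++ v :: d).getLast? = (a ++ v :: c ++ v :: d).getLast? ∧
    (∀ ab ∈ (a ++ v :: d).zip (a ++ v :: d).tail,
      ab ∈ (a ++ v :: c ++ v :: d).zip (a ++ v :: c ++ v :: d).tail) := by
  refine ⟨?_, ?_, ?_, ?_, ?_⟩
  · have h2 := (List.isChain_split.1 h).2
    have h1 : List.IsChain R (a ++ v :: (c ++ v :: d)) := by
      have h0 : List.IsChain R (a ++ v :: c ++ v :: d) := h
      simpa using h0
    exact List.isChain_split.2 ⟨(List.isChain_split.1 h1).1, h2⟩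
  · simp [List.count_append, List.count_eq_zero_of_not_mem hva,
      List.count_eq_zero_of_not_mem hvd]
  · cases a <;> simp
  · simp [List.getLast?_append, List.getLast?_cons]
  · intro p hp
    rw [pairs_split] at hp ⊢
    rcases hp with hp | hp
    · left
      have e : a ++ v :: c ++ [v] = a ++ v :: (c ++ [v]) := by simp
      rw [e, pairs_split]
      exact Or.inl hp
    · exact Or.inr hp
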